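/- For all integers k ≥ 3 and 1 ≤ ℓ < k/2 and all ε > 0 there exist θ, ξ > 0 and n₀ such that the following holds. Let n ≥ n₀ be divisible by k−ℓ, let H = (V,E) be an (ℓ,ξ)-extremal k-uniform hypergraph on n vertices with δ_{k−2}(H) > δ_{k−2}(X_{k,ℓ}(n)), let V = A ∪ B be a minimal extremal partition, and define A_ε, B_ε as above. Then every vertex v ∈ B_ε satisfies d(v, B_ε^(k−1)) < 2ε·C(|B_ε|, k−1), where d(v, B_ε^(k−1)) counts edges consisting of v and k−1 vertices of B_ε ∖ {v}. -/

import Mathlib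

open Finset

/-- `E` is the edge set of a `k`-uniform hypergraph on vertex set `Fin n`:
every edge is a `k`-element set of vertices. -/
def Uniform (n k : ℕ) (E : Finset (Finset (Fin n))) : Prop :=
  ∀ e ∈ E, e.card = k

/-- The degree `d(S)` of a vertex set `S`: the number of edges containing `S`. -/
def deg {n : ℕ} (E : Finset (Finset (Fin n))) (S : Finset (Fin n)) : ℕ :=
  (E.filter fun e => S ⊆ e).card

/-- The minimum `s`-degree `δ_s(H)`: the minimum of `d(S)` over all `s`-element
vertex sets `S`. -/
noncomputable def minDeg (n : ℕ) (E : Finset (Finset (Fin n))) (s : ℕ) : ℕ :=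
  sInf {d | ∃ S : Finset (Fin n), S.card = s ∧ deg E S = d}

/-- `d(L, X^(i) Y^(j))`: the number of edges of the form `L ∪ I ∪ J` with
`I ∈ X^(i)`, `J ∈ Y^(j)` (take `Y = ∅`, `j = 0` when `Y^(j)` is omitted). -/
def degIn {n : ℕ} (E : Finset (Finset (Fin n))) (L X Y : Finset (Fin n)) (i j : ℕ) : ℕ :=
  (E.filter fun e =>
    L ⊆ e ∧ e \ L ⊆ X ∪ Y ∧ ((e \ L) ∩ X).card = i ∧ ((e \ L) ∩ Y).card = j).card

/-- The `i`-th edge of an ℓ-cycle given by the cyclic ordering `f` of the `n`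
vertices: `k` cyclically consecutive vertices starting at position `i * (k - ℓ)`. -/
def cycEdge (n k ℓ : ℕ) (f : ℕ → Fin n) (i : ℕ) : Finset (Fin n) :=
  (Finset.range k).image fun j => f ((i * (k - ℓ) + j) % n)

/-- `H = (Fin n, E)` contains a Hamiltonian ℓ-cycle: there is a cyclic ordering of
all `n` vertices such that each of the `n / (k - ℓ)` windows of `k` consecutive
vertices (consecutive windows overlapping in `ℓ` vertices) is an edge, and two
consecutive edges share exactly `ℓ` vertices. -/
def HasHamCycle (n k ℓ : ℕ) (E : Finset (Finset (Fin n))) : Prop :=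
  ∃ f : ℕ → Fin n, Set.InjOn f (Set.Iio n) ∧
    (∀ i < n / (k - ℓ), cycEdge n k ℓ f i ∈ E) ∧
    (∀ i < n / (k - ℓ),
      (cycEdge n k ℓ f i ∩ cycEdge n k ℓ f ((i + 1) % (n / (k - ℓ)))).card = ℓ)

/-- The `i`-th edge of an ℓ-path given by the linear ordering `f`. -/
def pathEdge (n k ℓ : ℕ) (f : ℕ → Fin n) (i : ℕ) : Finset (Fin n) :=
  (Finset.range k).image fun j => f (i * (k - ℓ) + j)

/-- `f` is (the linear ordering of the vertices of) an ℓ-path with `t` edges all of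
which belong to `E`: the path has `t * (k - ℓ) + ℓ` vertices, every edge consists of
`k` consecutive vertices and two consecutive edges intersect in exactly `ℓ` vertices. -/
def IsPath (n k ℓ t : ℕ) (E : Finset (Finset (Fin n))) (f : ℕ → Fin n) : Prop :=
  Set.InjOn f (Set.Iio (t * (k - ℓ) + ℓ)) ∧ ∀ i < t, pathEdge n k ℓ f i ∈ E

/-- The vertex set of the ℓ-path described by `f` with `t` edges. -/
def pathVerts (n k ℓ t : ℕ) (f : ℕ → Fin n) : Finset (Fin n) :=
  (Finset.range (t * (k - ℓ) + ℓ)).image f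

/-- The first end (first `ℓ` vertices) of the ℓ-path described by `f`. -/
def pathEnd0 (n ℓ : ℕ) (f : ℕ → Fin n) : Finset (Fin n) :=
  (Finset.range ℓ).image f

/-- The last end (last `ℓ` vertices) of the ℓ-path described by `f` with `t` edges. -/
def pathEnd1 (n k ℓ t : ℕ) (f : ℕ → Fin n) : Finset (Fin n) :=
  (Finset.Ico (t * (k - ℓ)) (t * (k - ℓ) + ℓ)).image f

/-- The extremal hypergraph `X_{k,ℓ}(n)` on `Fin n`.  If `n` is an odd multiple of
`k - ℓ`, take `A` to be the first `⌊n / (2(k-ℓ))⌋` vertices and all `k`-sets meeting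
`A` as edges.  If `n` is an even multiple of `k - ℓ`, take `A` to be the first
`n / (2(k-ℓ)) - 1` vertices, fix the `ℓ + 1` following vertices (which lie in
`B = V ∖ A`), and take as edges all `k`-sets meeting `A` together with all `k`-subsets
of `B` containing all `ℓ + 1` fixed vertices. -/
def Xedges (n k ℓ : ℕ) : Finset (Finset (Fin n)) :=
  if Odd (n / (k - ℓ)) then
    (Finset.powersetCard k (Finset.univ : Finset (Fin n))).filter fun e =>
      ∃ v ∈ e, (v : ℕ) < n / (2 * (k - ℓ))
  else
    (Finset.powersetCard k (Finset.univ : Finset (Fin n))).filter fun e =>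
      (∃ v ∈ e, (v : ℕ) < n / (2 * (k - ℓ)) - 1) ∨
      ((∀ v ∈ e, n / (2 * (k - ℓ)) - 1 ≤ (v : ℕ)) ∧
        ∀ w : Fin n, n / (2 * (k - ℓ)) - 1 ≤ (w : ℕ) → (w : ℕ) < n / (2 * (k - ℓ)) + ℓ →
          w ∈ e)

/-- `e(B)`: the number of edges lying entirely inside `B`. -/
def edgesIn {n : ℕ} (E : Finset (Finset (Fin n))) (B : Finset (Fin n)) : ℕ :=
  (E.filter fun e => e ⊆ B).card

/-- `(A, B)` is an `(ℓ,ξ)`-extremal partition of the vertex set: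
`|A| = ⌈n/(2(k-ℓ))⌉ - 1`, `|B| = ⌊(2(k-ℓ)-1)n/(2(k-ℓ)) + 1⌋` and
`e(B) ≤ ξ · C(n,k)`. -/
def IsExtremalPartition (n k ℓ : ℕ) (E : Finset (Finset (Fin n))) (ξ : ℝ)
    (A B : Finset (Fin n)) : Prop :=
  Disjoint A B ∧ A ∪ B = Finset.univ ∧
  A.card = ⌈(n : ℝ) / (2 * ((k - ℓ : ℕ) : ℝ))⌉₊ - 1 ∧
  B.card = ⌊(2 * ((k - ℓ : ℕ) : ℝ) - 1) * (n : ℝ) / (2 * ((k - ℓ : ℕ) : ℝ)) + 1⌋₊ ∧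
  (edgesIn E B : ℝ) ≤ ξ * (n.choose k : ℝ)

/-- `H` is `(ℓ,ξ)`-extremal. -/
def IsExtremal (n k ℓ : ℕ) (E : Finset (Finset (Fin n))) (ξ : ℝ) : Prop :=
  ∃ A B, IsExtremalPartition n k ℓ E ξ A B

/-- `(A, B)` is a minimal `(ℓ,ξ)`-extremal partition: among all `(ℓ,ξ)`-extremal
partitions it minimises `e(B)`. -/
def IsMinExtremalPartition (n k ℓ : ℕ) (E : Finset (Finset (Fin n))) (ξ : ℝ)
    (A B : Finset (Fin n)) : Prop :=
  IsExtremalPartition n k ℓ E ξ A B ∧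
  ∀ A' B' : Finset (Fin n), IsExtremalPartition n k ℓ E ξ A' B' →
    edgesIn E B ≤ edgesIn E B'

open scoped Classical in
/-- `A_ε`: the set of vertices `v` with `d(v, B^(k-1)) ≥ (1-ε)·C(|B|, k-1)`. -/
noncomputable def Aeps (n k : ℕ) (E : Finset (Finset (Fin n))) (B : Finset (Fin n)) (ε : ℝ) :
    Finset (Fin n) :=
  Finset.univ.filter fun v =>
    (1 - ε) * (B.card.choose (k - 1) : ℝ) ≤ (degIn E {v} B ∅ (k - 1) 0 : ℝ)

open scoped Classical in
/-- `B_ε`: the set of vertices `v` with `d(v, B^(k-1)) ≤ ε·C(|B|, k-1)`. -/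
noncomputable def Beps (n k : ℕ) (E : Finset (Finset (Fin n))) (B : Finset (Fin n)) (ε : ℝ) :
    Finset (Fin n) :=
  Finset.univ.filter fun v =>
    (degIn E {v} B ∅ (k - 1) 0 : ℝ) ≤ ε * (B.card.choose (k - 1) : ℝ)

/-- `V_ε = V ∖ (A_ε ∪ B_ε)`. -/
noncomputable def Veps (n k : ℕ) (E : Finset (Finset (Fin n))) (B : Finset (Fin n)) (ε : ℝ) :
    Finset (Fin n) :=
  Finset.univ \ (Aeps n k E B ε ∪ Beps n k E B ε)

/-- `L` is an ε-typical ℓ-set: `L ⊆ B_ε`, `|L| = ℓ` and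
`d(L, B^(k-ℓ)) ≤ ε·C(|B|, k-ℓ)`. -/
def IsTypical (n k ℓ : ℕ) (E : Finset (Finset (Fin n))) (B : Finset (Fin n)) (ε : ℝ)
    (L : Finset (Fin n)) : Prop :=
  L.card = ℓ ∧ L ⊆ Beps n k E B ε ∧
    (degIn E L B ∅ (k - ℓ) 0 : ℝ) ≤ ε * (B.card.choose (k - ℓ) : ℝ)

/-- The number of `m`-sets between `S` and `B`. -/
theorem card_powersetCard_filter_superset {α : Type*} [DecidableEq α] (S B : Finset α) (m : ℕ)
    (hS : S ⊆ B) (hm : S.card ≤ m) :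
    ((B.powersetCard m).filter fun e => S ⊆ e).card = (B.card - S.card).choose (m - S.card) := by
  rw [← card_sdiff_of_subset hS, ← card_powersetCard]
  refine card_bij' (fun e _ => e \ S) (fun T _ => T ∪ S) ?_ ?_ ?_ ?_
  · intro e he
    simp only [mem_filter, mem_powersetCard] at he ⊢
    exact ⟨sdiff_subset_sdiff he.1.1 le_rfl, by rw [card_sdiff_of_subset he.2, he.1.2]⟩
  · intro T hT
    simp only [mem_filter, mem_powersetCard, subset_sdiff] at hT ⊢
    refine ⟨⟨union_subset hT.1.1 hS, ?_⟩, subset_union_right⟩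
    rw [card_union_of_disjoint hT.1.2, hT.2]
    omega
  · intro e he
    simp only [mem_filter] at he
    exact sdiff_union_of_subset he.2
  · intro T hT
    simp only [mem_powersetCard, subset_sdiff] at hT
    rw [union_sdiff_right]
    exact sdiff_eq_self_of_disjoint hT.1.2

/-- There are few `(r+1)`-subsets of `X` not contained in `Y` if `X \ Y` is small. -/
theorem card_powersetCard_filter_not_subset_le {α : Type*} [DecidableEq α] (X Y : Finset α)
    (r : ℕ) :
    ((X.powersetCard (r + 1)).filter fun T => ¬ T ⊆ Y).card ≤
      (X \ Y).card * X.card.choose r := by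
  rw [← card_powersetCard, ← card_product]
  refine (card_le_card (t := ((X \ Y) ×ˢ X.powersetCard r).image fun p => insert p.1 p.2) ?_).trans
    card_image_le
  intro T hT
  simp only [mem_filter, mem_powersetCard] at hT
  obtain ⟨x, hx, hxY⟩ := not_subset.1 hT.2
  simp only [mem_image, mem_product, mem_sdiff, mem_powersetCard, Prod.exists]
  exact ⟨x, T.erase x, ⟨⟨hT.1.1 hx, hxY⟩, (erase_subset _ _).trans hT.1.1,
    by rw [card_erase_of_mem hx, hT.1.2]; rfl⟩, insert_erase hx⟩

theorem choose_le_choose_add_mul {α : Type*} [DecidableEq α] (X Y : Finset α) (r : ℕ) :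
    X.card.choose (r + 1) ≤ Y.card.choose (r + 1) + (X \ Y).card * X.card.choose r := by
  rw [← card_powersetCard, ← card_powersetCard,
    ← card_filter_add_card_filter_not (s := X.powersetCard (r + 1)) (fun T => T ⊆ Y)]
  refine add_le_add (card_le_card ?_) (card_powersetCard_filter_not_subset_le X Y r)
  intro T hT
  simp only [mem_filter, mem_powersetCard] at hT ⊢
  exact ⟨hT.2, hT.1.2⟩

theorem mul_choose_le (n b r : ℕ) (h : n ≤ 2 * (b - r)) :
    n * b.choose r ≤ 2 * (r + 1) * b.choose (r + 1) := by
  have := Nat.choose_succ_right_eq b r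
  calc n * b.choose r ≤ 2 * (b - r) * b.choose r := Nat.mul_le_mul_right _ h
    _ = 2 * (r + 1) * b.choose (r + 1) := by
      rw [mul_assoc, mul_comm (b - r), ← this]
      ring

theorem mul_choose_le_two_pow_mul (n b r : ℕ) (h : n ≤ 2 * (b - r)) :
    (r + 2) * n.choose (r + 2) ≤ n * (2 ^ (r + 1) * b.choose (r + 1)) := by
  have h1 : n.choose (r + 1) ≤ 2 ^ (r + 1) * b.choose (r + 1) := by
    refine Nat.le_of_mul_le_mul_left ?_ (Nat.factorial_pos (r + 1))
    rw [← Nat.descFactorial_eq_factorial_mul_choose, mul_left_comm,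
      ← Nat.descFactorial_eq_factorial_mul_choose]
    calc n.descFactorial (r + 1) ≤ n ^ (r + 1) := Nat.descFactorial_le_pow _ _
      _ ≤ (2 * (b - r)) ^ (r + 1) := Nat.pow_le_pow_left h _
      _ = 2 ^ (r + 1) * (b + 1 - (r + 1)) ^ (r + 1) := by
        rw [mul_pow, Nat.add_sub_add_right]
      _ ≤ _ := Nat.mul_le_mul_left _ (Nat.pow_sub_le_descFactorial _ _)
  calc (r + 2) * n.choose (r + 2) = n.choose (r + 1) * (n - (r + 1)) := by
        rw [← Nat.choose_succ_right_eq, mul_comm]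
    _ ≤ n.choose (r + 1) * n := Nat.mul_le_mul_left _ (Nat.sub_le _ _)
    _ ≤ _ := by rw [mul_comm]; exact Nat.mul_le_mul_left _ h1

theorem degIn_singleton_eq_card_filter {n : ℕ} {E : Finset (Finset (Fin n))} {m : ℕ}
    (hE : Uniform n (m + 1) E) (v : Fin n) (X : Finset (Fin n)) :
    degIn E {v} X ∅ m 0 = (E.filter fun e => v ∈ e ∧ e.erase v ⊆ X).card := by
  unfold degIn
  congr 1
  ext e
  simp only [mem_filter, singleton_subset_iff, union_empty, inter_empty, card_empty, and_true,
    sdiff_singleton_eq_erase]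
  refine ⟨fun h => ⟨h.1, h.2.1, h.2.2.1⟩, fun h => ⟨h.1, h.2.1, h.2.2, ?_⟩⟩
  rw [inter_eq_left.2 h.2.2, card_erase_of_mem h.2.1, hE e h.1]
  rfl

theorem degIn_le_card_filter {n : ℕ} {E : Finset (Finset (Fin n))} {m : ℕ}
    (hE : Uniform n (m + 1) E) (v : Fin n) (X : Finset (Fin n)) :
    degIn E {v} X ∅ m 0 ≤ ((X.powersetCard m).filter fun T => insert v T ∈ E).card := by
  rw [degIn_singleton_eq_card_filter hE]
  refine card_le_card_of_injOn (fun e => e.erase v) ?_ ?_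
  · intro e he
    simp only [coe_filter, Set.mem_ofPred_eq, mem_powersetCard] at he ⊢
    exact ⟨⟨he.2.2, by rw [card_erase_of_mem he.2.1, hE e he.1]; rfl⟩,
      by rw [insert_erase he.2.1]; exact he.1⟩
  · intro e he f hf hef
    simp only [coe_filter, Set.mem_ofPred_eq] at he hf
    rw [← insert_erase he.2.1, ← insert_erase hf.2.1]
    exact congrArg _ hef

theorem degIn_eq_card_filter {n : ℕ} {E : Finset (Finset (Fin n))} {m : ℕ}
    (hE : Uniform n (m + 1) E) {v : Fin n} {X : Finset (Fin n)} (hv : v ∉ X) :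
    degIn E {v} X ∅ m 0 = ((X.powersetCard m).filter fun T => insert v T ∈ E).card := by
  refine (degIn_le_card_filter hE v X).antisymm ?_
  rw [degIn_singleton_eq_card_filter hE]
  refine card_le_card_of_injOn (fun T => insert v T) ?_ ?_
  · intro T hT
    simp only [coe_filter, Set.mem_ofPred_eq, mem_powersetCard] at hT ⊢
    exact ⟨hT.2, mem_insert_self _ _, by
      rw [erase_insert fun h => hv (hT.1.1 h)]; exact hT.1.1⟩
  · intro T hT U hU hTU
    simp only [coe_filter, Set.mem_ofPred_eq, mem_powersetCard] at hT hU
    rw [← erase_insert fun h => hv (hT.1.1 h), ← erase_insert fun h => hv (hU.1.1 h)]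
    exact congrArg (fun s => erase s v) hTU

theorem degIn_le_choose {n : ℕ} {E : Finset (Finset (Fin n))} {m : ℕ}
    (hE : Uniform n (m + 1) E) (v : Fin n) (X : Finset (Fin n)) :
    degIn E {v} X ∅ m 0 ≤ X.card.choose m :=
  (degIn_le_card_filter hE v X).trans ((card_filter_le _ _).trans (card_powersetCard _ _).le)

theorem degIn_le_degIn_add {n : ℕ} {E : Finset (Finset (Fin n))} {r : ℕ}
    (hE : Uniform n (r + 2) E) (v : Fin n) (X Y : Finset (Fin n)) :
    degIn E {v} X ∅ (r + 1) 0 ≤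
      degIn E {v} Y ∅ (r + 1) 0 + (X \ Y).card * X.card.choose r := by
  refine le_trans ?_ (add_le_add_right (card_powersetCard_filter_not_subset_le X Y r) _)
  rw [degIn_singleton_eq_card_filter hE, degIn_singleton_eq_card_filter hE,
    ← card_filter_add_card_filter_not (s := E.filter _) (fun e => e.erase v ⊆ Y)]
  refine add_le_add (card_le_card ?_) ?_
  · intro e he
    simp only [mem_filter] at he ⊢
    exact ⟨he.1.1, he.1.2.1, he.2⟩
  · refine card_le_card_of_injOn (fun e => e.erase v) ?_ ?_
    · intro e he
      simp only [coe_filter, Set.mem_ofPred_eq, mem_powersetCard, mem_filter] at he ⊢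
      exact ⟨⟨he.1.2.2, by rw [card_erase_of_mem he.1.2.1, hE e he.1.1]; rfl⟩, he.2⟩
    · intro e he f hf hef
      simp only [coe_filter, Set.mem_ofPred_eq, mem_filter] at he hf
      rw [← insert_erase he.1.2.1, ← insert_erase hf.1.2.1]
      exact congrArg _ hef

/-- Handshake inequality inside `B`. -/
theorem sum_degIn_le {n : ℕ} {E : Finset (Finset (Fin n))} {m : ℕ}
    (hE : Uniform n (m + 1) E) (B : Finset (Fin n)) (W : Finset (Fin n)) (hW : W ⊆ B) :
    ∑ v ∈ W, degIn E {v} B ∅ m 0 ≤ (m + 1) * edgesIn E B := by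
  have h : ∀ v ∈ W, degIn E {v} B ∅ m 0 =
      ((E.filter fun e => e ⊆ B).filter fun e => v ∈ e).card := by
    intro v hv
    rw [degIn_singleton_eq_card_filter hE, filter_filter]
    congr 1
    ext e
    simp only [mem_filter, and_congr_right_iff]
    refine fun _ => ⟨fun h => ⟨?_, h.1⟩, fun h => ⟨h.2, (erase_subset _ _).trans h.1⟩⟩
    rw [← insert_erase h.1]
    exact insert_subset (hW hv) h.2
  rw [sum_congr rfl h]
  have := sum_card_bipartiteAbove_eq_sum_card_bipartiteBelow (s := W)
    (t := E.filter fun e => e ⊆ B) (fun v e => v ∈ e)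
  unfold bipartiteAbove bipartiteBelow at this
  rw [this, edgesIn, mul_comm, ← smul_eq_mul]
  refine sum_le_card_nsmul _ _ _ fun e he => ?_
  rw [← hE e (mem_filter.1 he).1]
  exact card_le_card fun v hv => (mem_filter.1 hv).2

theorem minDeg_le_deg {n s : ℕ} (E : Finset (Finset (Fin n))) (S : Finset (Fin n))
    (hS : S.card = s) : minDeg n E s ≤ deg E S :=
  Nat.sInf_le ⟨S, hS, rfl⟩

theorem exists_deg_eq_minDeg {n s : ℕ} (E : Finset (Finset (Fin n))) (hs : s ≤ n) :
    ∃ S : Finset (Fin n), S.card = s ∧ deg E S = minDeg n E s := by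
  obtain ⟨S, -, hS⟩ := exists_subset_card_eq (s := (univ : Finset (Fin n))) (n := s) (by simpa)
  exact Nat.sInf_mem (s := {d | ∃ S : Finset (Fin n), S.card = s ∧ deg E S = d}) ⟨_, S, hS, rfl⟩

theorem ceil_half_sub_one_le {q : ℕ} :
    ⌈(q : ℝ) / 2⌉₊ - 1 ≤ if Odd q then q / 2 else q / 2 - 1 := by
  split_ifs with h
  · have : ⌈(q : ℝ) / 2⌉₊ ≤ q / 2 + 1 := by
      rw [Nat.ceil_le]
      have : (q : ℝ) ≤ 2 * (q / 2 + 1 : ℕ) := by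
        exact_mod_cast (by omega : q ≤ 2 * (q / 2 + 1))
      linarith
    omega
  · have : ⌈(q : ℝ) / 2⌉₊ ≤ q / 2 := by
      rw [Nat.ceil_le]
      obtain ⟨m, rfl⟩ := even_iff_exists_two_mul.1 (Nat.not_odd_iff_even.1 h)
      rw [Nat.mul_div_cancel_left _ two_pos]
      push_cast
      linarith
    omega

/-- Size of the first part of an extremal partition, compared with `n` and with the
distinguished set of `X_{k,ℓ}(n)`. -/
theorem card_le_of_isExtremalPartition {n k ℓ : ℕ} {E : Finset (Finset (Fin n))} {ξ : ℝ}
    {A B : Finset (Fin n)} (h : IsExtremalPartition n k ℓ E ξ A B) (hn : k - ℓ ∣ n)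
    (hk : 2 ≤ k - ℓ) :
    (A.card ≤ if Odd (n / (k - ℓ)) then n / (2 * (k - ℓ)) else n / (2 * (k - ℓ)) - 1) ∧
      4 * A.card ≤ n := by
  obtain ⟨-, -, hA, -, -⟩ := h
  obtain ⟨q, hq⟩ := hn
  generalize k - ℓ = d at *
  subst hq
  have hd : (d : ℝ) ≠ 0 := by
    exact_mod_cast (by omega : d ≠ 0)
  have h1 : ((d * q : ℕ) : ℝ) / (2 * (d : ℝ)) = q / 2 := by
    push_cast
    field_simp
  have h2 : d * q / (2 * d) = q / 2 := by
    rw [mul_comm 2 d, Nat.mul_div_mul_left _ _ (by omega)]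
  rw [h1] at hA
  rw [h2, Nat.mul_div_cancel_left _ (by omega : 0 < d), hA]
  refine ⟨ceil_half_sub_one_le, ?_⟩
  have h3 := ceil_half_sub_one_le (q := q)
  have h4 : 2 * q ≤ d * q := Nat.mul_le_mul_right _ hk
  split_ifs at h3 <;> omega

/-- A set of size at most `k` has all its `k`-supersets in `X_{k,ℓ}(n)`, up to those avoiding
the distinguished set. -/
theorem card_filter_superset_le_deg_Xedges_add {n k ℓ a : ℕ}
    (ha : a ≤ if Odd (n / (k - ℓ)) then n / (2 * (k - ℓ)) else n / (2 * (k - ℓ)) - 1)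
    (han : a ≤ n) (S : Finset (Fin n)) (hS : S.card ≤ k) :
    ((univ.powersetCard k).filter fun e => S ⊆ e).card ≤
      deg (Xedges n k ℓ) S + (n - a - S.card).choose (k - S.card) := by
  classical
  set R : Finset (Fin n) := univ.filter fun v => a ≤ (v : ℕ) with hR
  have hRc : R.card = n - a := by
    have h1 : (univ.filter fun v : Fin n => ¬ a ≤ (v : ℕ)).card = a := by
      have := Fin.card_filter_val_lt (n := n) (m := a)
      simp only [not_le]
      rw [this]
      omega
    have := card_filter_add_card_filter_not (s := (univ : Finset (Fin n))) (fun v => a ≤ (v : ℕ))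
    rw [h1, card_univ, Fintype.card_fin] at this
    rw [hR]
    omega
  rw [← card_filter_add_card_filter_not
    (s := (univ.powersetCard k).filter fun e : Finset (Fin n) => S ⊆ e) (fun e => e ∈ Xedges n k ℓ)]
  refine add_le_add (card_le_card ?_) ?_
  · intro e he
    simp only [mem_filter] at he ⊢
    exact ⟨he.2, he.1.2⟩
  · have key : ∀ e : Finset (Fin n), e.card = k → e ∉ Xedges n k ℓ → e ⊆ R := by
      intro e hek he v hv
      by_contra hvR
      apply he
      simp only [hR, mem_filter, mem_univ, true_and, not_le] at hvR
      unfold Xedges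
      split_ifs at ha ⊢
      · simp only [mem_filter, mem_powersetCard, subset_univ, true_and]
        exact ⟨hek, v, hv, hvR.trans_le ha⟩
      · simp only [mem_filter, mem_powersetCard, subset_univ, true_and]
        exact ⟨hek, Or.inl ⟨v, hv, hvR.trans_le ha⟩⟩
    by_cases hSR : S ⊆ R
    · rw [← hRc, ← card_powersetCard_filter_superset S R k hSR hS]
      refine card_le_card fun e he => ?_
      simp only [mem_filter, mem_powersetCard, subset_univ, true_and] at he ⊢
      exact ⟨⟨key e he.1.1 he.2, he.1.1⟩, he.1.2⟩
    · rw [card_eq_zero.2]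
      · exact Nat.zero_le _
      · refine filter_eq_empty_iff.2 fun e he hX => hSR ?_
        simp only [mem_filter, mem_powersetCard, subset_univ, true_and] at he
        exact he.2.trans (key e he.1 hX)

/-- Under the codegree condition, a `(k-2)`-subset `S` of `B` is in at most as many non-edges
leaving `B` as it is in edges inside `B`. -/
theorem card_nonedges_le {n r ℓ : ℕ} {E : Finset (Finset (Fin n))} (hE : Uniform n (r + 2) E)
    {A B : Finset (Fin n)} (hdisj : Disjoint A B) (hun : A ∪ B = univ)
    (ha : A.card ≤ if Odd (n / (r + 2 - ℓ)) then n / (2 * (r + 2 - ℓ))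
      else n / (2 * (r + 2 - ℓ)) - 1)
    (hr : r ≤ n) (hdeg : minDeg n (Xedges n (r + 2) ℓ) r < minDeg n E r)
    {S : Finset (Fin n)} (hS : S ⊆ B) (hSr : S.card = r) :
    ((univ.powersetCard (r + 2)).filter fun e => S ⊆ e ∧ e ∉ E ∧ ¬ e ⊆ B).card ≤
      (E.filter fun e => e ⊆ B ∧ S ⊆ e).card := by
  classical
  obtain ⟨S₀, hS₀, hd₀⟩ := exists_deg_eq_minDeg (Xedges n (r + 2) ℓ) hr
  have hcard : A.card + B.card = n := by
    rw [← card_union_of_disjoint hdisj, hun, card_univ, Fintype.card_fin]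
  have h1 := card_filter_superset_le_deg_Xedges_add ha (by omega) S₀ (by omega)
  have h2 := minDeg_le_deg E S hSr
  rw [card_powersetCard_filter_superset S₀ univ _ (subset_univ _) (by omega), hS₀,
    show n - A.card = B.card by omega, hd₀, ← hSr,
    ← card_powersetCard_filter_superset S univ _ (subset_univ _) (by omega),
    ← card_powersetCard_filter_superset S B _ hS (by omega), hSr] at h1
  have h3 := card_filter_add_card_filter_not
    (s := (univ.powersetCard (r + 2)).filter fun e : Finset (Fin n) => S ⊆ e) (fun e => e ∈ E)
  have h4 := card_filter_add_card_filter_not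
    (s := ((univ.powersetCard (r + 2)).filter fun e : Finset (Fin n) => S ⊆ e).filter
      fun e => e ∉ E) (fun e => e ⊆ B)
  have h5 := card_filter_add_card_filter_not
    (s := (B.powersetCard (r + 2)).filter fun e : Finset (Fin n) => S ⊆ e) (fun e => e ∈ E)
  have e1 : (((univ.powersetCard (r + 2)).filter fun e : Finset (Fin n) => S ⊆ e).filter
      fun e => e ∈ E) = E.filter fun e => S ⊆ e := by
    ext e
    simp only [mem_filter, mem_powersetCard, subset_univ, true_and]
    exact ⟨fun h => ⟨h.2, h.1.2⟩, fun h => ⟨⟨hE e h.1, h.2⟩, h.1⟩⟩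
  have e2 : ((((univ.powersetCard (r + 2)).filter fun e : Finset (Fin n) => S ⊆ e).filter
      fun e => e ∉ E).filter fun e => e ⊆ B) =
      ((B.powersetCard (r + 2)).filter fun e : Finset (Fin n) => S ⊆ e).filter
        fun e => e ∉ E := by
    ext e
    simp only [mem_filter, mem_powersetCard, subset_univ, true_and]
    tauto
  have e3 : (((B.powersetCard (r + 2)).filter fun e : Finset (Fin n) => S ⊆ e).filter
      fun e => e ∈ E) = E.filter fun e => e ⊆ B ∧ S ⊆ e := by
    ext e
    simp only [mem_filter, mem_powersetCard]
    exact ⟨fun h => ⟨h.2, h.1.1.1, h.1.2⟩, fun h => ⟨⟨⟨h.2.1, hE e h.1⟩, h.2.2⟩, h.1⟩⟩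
  rw [e1] at h3
  rw [e2] at h4
  rw [e3] at h5
  unfold deg at h2
  simp only [filter_filter, and_assoc] at h3 h4 h5
  omega

/-- There are at most `2 ^ k * e(B)` pairs `(a, T)`, with `a ∈ A` and `T` a `(k-1)`-subset of `B`,
that do not form an edge. -/
theorem card_nonedge_pairs_le {n r ℓ : ℕ} {E : Finset (Finset (Fin n))}
    (hE : Uniform n (r + 2) E) {A B : Finset (Fin n)} (hdisj : Disjoint A B)
    (hun : A ∪ B = univ)
    (ha : A.card ≤ if Odd (n / (r + 2 - ℓ)) then n / (2 * (r + 2 - ℓ))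
      else n / (2 * (r + 2 - ℓ)) - 1)
    (hr : r ≤ n) (hdeg : minDeg n (Xedges n (r + 2) ℓ) r < minDeg n E r) :
    ((A ×ˢ B.powersetCard (r + 1)).filter fun p => insert p.1 p.2 ∉ E).card ≤
      2 ^ (r + 2) * edgesIn E B := by
  classical
  set P := (A ×ˢ B.powersetCard (r + 1)).filter fun p => insert p.1 p.2 ∉ E with hP
  have hmem : ∀ p ∈ P, p.1 ∉ B ∧ p.2 ⊆ B ∧ p.2.card = r + 1 ∧ insert p.1 p.2 ∉ E := by
    intro p hp
    simp only [hP, mem_filter, mem_product, mem_powersetCard] at hp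
    exact ⟨disjoint_left.1 hdisj hp.1.1, hp.1.2.1, hp.1.2.2, hp.2⟩
  have hinj : Set.InjOn (fun p : Fin n × Finset (Fin n) => insert p.1 p.2) P := by
    rintro ⟨a, T⟩ hp ⟨a', T'⟩ hp' h
    obtain ⟨h1, h2, -, -⟩ := hmem _ hp
    obtain ⟨h1', h2', -, -⟩ := hmem _ hp'
    simp only at h h1 h2 h1' h2'
    have haa : a = a' := by
      have : a ∈ insert a' T' := h ▸ mem_insert_self a T
      exact (mem_insert.1 this).resolve_right fun h => h1 (h2' h)
    subst haa
    rw [Prod.mk.injEq]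
    refine ⟨rfl, ?_⟩
    rw [← erase_insert fun h => h1 (h2 h), h, erase_insert fun h => h1 (h2' h)]
  rw [← card_image_of_injOn hinj]
  calc _ ≤ ((B.powersetCard r).biUnion fun S => (univ.powersetCard (r + 2)).filter
        fun e => S ⊆ e ∧ e ∉ E ∧ ¬ e ⊆ B).card := by
        refine card_le_card fun e he => ?_
        obtain ⟨⟨a, T⟩, hp, rfl⟩ := mem_image.1 he
        obtain ⟨h1, h2, h3, h4⟩ := hmem _ hp
        simp only at h1 h2 h3 h4
        obtain ⟨S, hST, hS⟩ := exists_subset_card_eq (s := T) (n := r) (by omega)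
        simp only [mem_biUnion, mem_filter, mem_powersetCard, subset_univ, true_and]
        refine ⟨S, ⟨hST.trans h2, hS⟩, ?_, hST.trans (subset_insert _ _), h4,
          fun h => h1 (h (mem_insert_self _ _))⟩
        rw [card_insert_of_notMem fun h => h1 (h2 h), h3]
    _ ≤ ∑ S ∈ B.powersetCard r, ((univ.powersetCard (r + 2)).filter
        fun e => S ⊆ e ∧ e ∉ E ∧ ¬ e ⊆ B).card := card_biUnion_le
    _ ≤ ∑ S ∈ B.powersetCard r, ((E.filter fun e => e ⊆ B).filter fun e => S ⊆ e).card := by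
        refine sum_le_sum fun S hS => ?_
        rw [mem_powersetCard] at hS
        rw [filter_filter]
        exact card_nonedges_le hE hdisj hun ha hr hdeg hS.1 hS.2
    _ = ∑ e ∈ E.filter fun e => e ⊆ B, ((B.powersetCard r).filter fun S => S ⊆ e).card :=
        sum_card_bipartiteAbove_eq_sum_card_bipartiteBelow (fun S e : Finset (Fin n) => S ⊆ e)
    _ ≤ edgesIn E B * 2 ^ (r + 2) := by
        refine sum_le_card_nsmul _ _ _ fun e he => ?_
        rw [← hE e (mem_filter.1 he).1, ← card_powerset]
        exact card_le_card fun S hS => mem_powerset.2 (mem_filter.1 hS).2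
    _ = _ := mul_comm _ _

theorem mem_Beps {n m : ℕ} {E : Finset (Finset (Fin n))} {B : Finset (Fin n)} {ε : ℝ}
    {v : Fin n} : v ∈ Beps n (m + 1) E B ε ↔
      (degIn E {v} B ∅ m 0 : ℝ) ≤ ε * (B.card.choose m : ℝ) := by
  simp [Beps]

/-- Few vertices of `B` lie outside `B_ε`. -/
theorem card_sdiff_Beps_mul_le {n r : ℕ} {E : Finset (Finset (Fin n))}
    (hE : Uniform n (r + 2) E) (B : Finset (Fin n)) (ε : ℝ) :
    ((B \ Beps n (r + 2) E B ε).card : ℝ) * (ε * B.card.choose (r + 1)) ≤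
      (r + 2) * edgesIn E B := by
  have h1 := sum_degIn_le hE B (B \ Beps n (r + 2) E B ε) sdiff_subset
  rw [← nsmul_eq_mul]
  refine (card_nsmul_le_sum _ (fun v => (degIn E {v} B ∅ (r + 1) 0 : ℝ)) _ ?_).trans ?_
  · intro v hv
    have := (mem_sdiff.1 hv).2
    rw [mem_Beps, not_le] at this
    exact this.le
  · rw [← Nat.cast_sum]
    refine (Nat.cast_le.2 h1).trans (le_of_eq ?_)
    push_cast
    ring

/-- Few vertices of `A` lie in `B_ε`. -/
theorem card_Beps_sdiff_mul_le {n r ℓ : ℕ} {E : Finset (Finset (Fin n))}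
    (hE : Uniform n (r + 2) E) {A B : Finset (Fin n)} (hdisj : Disjoint A B)
    (hun : A ∪ B = univ)
    (ha : A.card ≤ if Odd (n / (r + 2 - ℓ)) then n / (2 * (r + 2 - ℓ))
      else n / (2 * (r + 2 - ℓ)) - 1)
    (hr : r ≤ n) (hdeg : minDeg n (Xedges n (r + 2) ℓ) r < minDeg n E r) (ε : ℝ) :
    ((Beps n (r + 2) E B ε \ B).card : ℝ) * ((1 - ε) * B.card.choose (r + 1)) ≤
      2 ^ (r + 2) * edgesIn E B := by
  classical
  set W := Beps n (r + 2) E B ε \ B with hW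
  have hWA : W ⊆ A := fun v hv =>
    (mem_union.1 (hun ▸ mem_univ v : v ∈ A ∪ B)).resolve_right (mem_sdiff.1 hv).2
  have h1 : ∑ v ∈ W, ((B.powersetCard (r + 1)).filter fun T => insert v T ∉ E).card ≤
      2 ^ (r + 2) * edgesIn E B := by
    refine le_trans (b := ((W ×ˢ B.powersetCard (r + 1)).filter
      fun p => insert p.1 p.2 ∉ E).card) (le_of_eq ?_)
      ((card_le_card ?_).trans (card_nonedge_pairs_le hE hdisj hun ha hr hdeg))
    · simp only [card_filter, sum_product]
    · exact filter_subset_filter _ (product_subset_product hWA le_rfl)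
  rw [← nsmul_eq_mul]
  refine (card_nsmul_le_sum _
    (fun v => (((B.powersetCard (r + 1)).filter fun T => insert v T ∉ E).card : ℝ)) _ ?_).trans ?_
  · intro v hv
    have h2 := mem_Beps.1 (mem_sdiff.1 hv).1
    have h3 := card_filter_add_card_filter_not (s := B.powersetCard (r + 1))
      (fun T => insert v T ∈ E)
    rw [degIn_eq_card_filter hE (mem_sdiff.1 hv).2] at h2
    rw [card_powersetCard] at h3
    have h4 : (((B.powersetCard (r + 1)).filter fun T => insert v T ∈ E).card : ℝ) +
      ((B.powersetCard (r + 1)).filter fun T => insert v T ∉ E).card =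
        B.card.choose (r + 1) := by exact_mod_cast h3
    linarith
  · exact_mod_cast h1

/-- The estimate combining the bounds on the symmetric difference of `B` and `B_ε`: here `b, b'`
stand for `C(|B|, k-1), C(|B|, k-2)` and `c, c'` for `C(|B_ε|, k-1), C(|B_ε|, k-2)`. -/
theorem lt_two_mul_mul_of_le {ε η m n x y b b' c c' dB dD : ℝ} (hε : 0 < ε) (hη : 0 ≤ η)
    (hε1 : ε ≤ 1) (hm : 2 * m * η = ε / 4) (hD : dD ≤ dB + x * c') (hB : dB ≤ ε * b)
    (hbc : b ≤ c + y * b') (hx : x ≤ η * n) (hy : y ≤ η * n) (hc : n * c' ≤ 2 * m * c)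
    (hb : n * b' ≤ 2 * m * b) (hc0 : 0 < c) (hb0 : 0 ≤ b) (hb' : 0 ≤ b') (hc' : 0 ≤ c') :
    dD < 2 * ε * c := by
  have hscale : ∀ z t T : ℝ, 0 ≤ t → z ≤ η * n → n * t ≤ 2 * m * T → z * t ≤ ε / 4 * T :=
    fun z t T ht hz htT => by
      calc z * t ≤ η * n * t := by gcongr
        _ = η * (n * t) := by ring
        _ ≤ η * (2 * m * T) := by gcongr
        _ = 2 * m * η * T := by ring
        _ = ε / 4 * T := by rw [hm]
  have h1 := hscale _ _ _ hc' hx hc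
  have h2 := hscale _ _ _ hb' hy hb
  have h3 : b ≤ 4 / 3 * c := by
    have : ε * b ≤ 1 * b := by gcongr
    linarith
  have h4 : ε * b ≤ ε * (4 / 3 * c) := by gcongr
  have h5 : 0 < ε * c := by positivity
  linarith

/-- For all integers `k ≥ 3` and `1 ≤ ℓ < k/2` and all `ε > 0` there
exist `θ, ξ > 0` and `n₀` such that in the usual extremal setup, every vertex
`v ∈ B_ε` satisfies `d(v, B_ε^(k-1)) < 2ε·C(|B_ε|, k-1)`. -/
theorem statement16 (k ℓ : ℕ) (hk : 3 ≤ k) (hl : 1 ≤ ℓ) (hlk : 2 * ℓ < k)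
    (ε : ℝ) (hε : 0 < ε) :
    ∃ θ ξ : ℝ, 0 < θ ∧ 0 < ξ ∧ ∃ n₀ : ℕ, ∀ n : ℕ, n₀ ≤ n → (k - ℓ) ∣ n →
      ∀ E : Finset (Finset (Fin n)), Uniform n k E →
        ∀ A B : Finset (Fin n), IsMinExtremalPartition n k ℓ E ξ A B →
          minDeg n (Xedges n k ℓ) (k - 2) < minDeg n E (k - 2) →
          ∀ v ∈ Beps n k E B ε,
            (degIn E {v} (Beps n k E B ε) ∅ (k - 1) 0 : ℝ) <
              2 * ε * ((Beps n k E B ε).card.choose (k - 1) : ℝ) := by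
  obtain ⟨r, rfl⟩ : ∃ r, k = r + 2 := ⟨k - 2, by omega⟩
  simp only [show r + 2 - 1 = r + 1 from rfl, show r + 2 - 2 = r from rfl]
  rcases le_or_gt 1 ε with hε1 | hε1
  · refine ⟨1, 1, one_pos, one_pos, r + 1, fun n hn hdvd E hE A B hAB hdeg v hv => ?_⟩
    have hu : Beps n (r + 2) E B ε = univ := by
      refine eq_univ_iff_forall.2 fun w => mem_Beps.2 ?_
      refine (Nat.cast_le.2 (degIn_le_choose hE w B)).trans ?_
      exact le_mul_of_one_le_left (Nat.cast_nonneg _) hε1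
    rw [hu, card_univ, Fintype.card_fin]
    have h1 : (degIn E {v} univ ∅ (r + 1) 0 : ℝ) ≤ n.choose (r + 1) := by
      have := degIn_le_choose hE v univ
      rw [card_univ, Fintype.card_fin] at this
      exact_mod_cast this
    have h2 : (0 : ℝ) < n.choose (r + 1) := by
      exact_mod_cast Nat.choose_pos hn
    nlinarith
  obtain ⟨η, hη⟩ : ∃ η : ℝ, η = ε / (8 * (r + 1)) := ⟨_, rfl⟩
  have hr : (0 : ℝ) < r + 1 := by positivity
  have hηpos : 0 < η := by rw [hη]; positivity
  have hηr : 2 * (r + 1) * η = ε / 4 := by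
    rw [hη]
    field_simp
    norm_num
  obtain ⟨ξ, hξ⟩ : ∃ ξ : ℝ, ξ = η * (ε * (1 - ε)) / (2 ^ (r + 2) * 2 ^ (r + 1)) := ⟨_, rfl⟩
  have hε' : 0 < 1 - ε := by linarith
  have hξpos : 0 < ξ := by rw [hξ]; positivity
  have hξK : 2 ^ (r + 2) * (ξ * 2 ^ (r + 1)) = η * (ε * (1 - ε)) := by
    rw [hξ]
    field_simp
  refine ⟨1, ξ, one_pos, hξpos, 16 * (r + 2), fun n hn hdvd E hE A B hAB hdeg v hv => ?_⟩
  obtain ⟨hex, -⟩ := hAB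
  obtain ⟨ha, ha4⟩ := card_le_of_isExtremalPartition hex hdvd (by omega)
  obtain ⟨hdisj, hun, -, -, heB⟩ := hex
  have hcard : A.card + B.card = n := by
    rw [← card_union_of_disjoint hdisj, hun, card_univ, Fintype.card_fin]
  have hout := card_sdiff_Beps_mul_le hE B ε
  have hin := card_Beps_sdiff_mul_le hE hdisj hun ha (by omega) hdeg ε
  have hv' : (degIn E {v} B ∅ (r + 1) 0 : ℝ) ≤ ε * B.card.choose (r + 1) := by
    rwa [mem_Beps] at hv
  generalize Beps n (r + 2) E B ε = D at hout hin ⊢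
  have hCb : (0 : ℝ) < B.card.choose (r + 1) := by
    exact_mod_cast Nat.choose_pos (by omega)
  have hK : ((r : ℝ) + 2) * n.choose (r + 2) ≤ n * (2 ^ (r + 1) * B.card.choose (r + 1)) := by
    exact_mod_cast mul_choose_le_two_pow_mul n B.card r (by omega)
  have hpow : (r : ℝ) + 2 ≤ 2 ^ (r + 2) := by
    exact_mod_cast (Nat.lt_two_pow_self (n := r + 2)).le
  have hbase : 2 ^ (r + 2) * (edgesIn E B : ℝ) ≤
      η * (ε * (1 - ε)) * n * B.card.choose (r + 1) := by
    calc 2 ^ (r + 2) * (edgesIn E B : ℝ) ≤ 2 ^ (r + 2) * (ξ * n.choose (r + 2)) := by gcongr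
      _ ≤ 2 ^ (r + 2) * (ξ * (n * (2 ^ (r + 1) * B.card.choose (r + 1)))) := by
        have : (n.choose (r + 2) : ℝ) ≤ (r + 2) * n.choose (r + 2) :=
          le_mul_of_one_le_left (Nat.cast_nonneg _) (by linarith)
        gcongr
        exact this.trans hK
      _ = (2 ^ (r + 2) * (ξ * 2 ^ (r + 1))) * n * B.card.choose (r + 1) := by ring
      _ = _ := by rw [hξK]
  have hnn : (0 : ℝ) ≤ n := Nat.cast_nonneg n
  have hout' : ((B \ D).card : ℝ) ≤ η * n := by
    have h1 : ((B \ D).card : ℝ) * (ε * B.card.choose (r + 1)) ≤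
        (η * n * (1 - ε)) * (ε * B.card.choose (r + 1)) := by
      have : ((r : ℝ) + 2) * edgesIn E B ≤ 2 ^ (r + 2) * edgesIn E B := by gcongr
      linarith
    have h2 := le_of_mul_le_mul_right h1 (by positivity)
    have h3 : 0 ≤ η * n * ε := by positivity
    linarith
  have hin' : ((D \ B).card : ℝ) ≤ η * n := by
    have h1 : ((D \ B).card : ℝ) * ((1 - ε) * B.card.choose (r + 1)) ≤
        (η * n * ε) * ((1 - ε) * B.card.choose (r + 1)) := by
      linarith
    have h2 := le_of_mul_le_mul_right h1 (by positivity)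
    have h3 : 0 ≤ η * n * (1 - ε) := by positivity
    linarith
  have hη8 : η ≤ 1 / 8 := by
    have h1 : (0 : ℝ) ≤ r * η := by positivity
    linarith
  have hDcard : n ≤ 2 * (D.card - r) := by
    have h1 : B.card ≤ D.card + (B \ D).card := by
      have := card_le_card_sdiff_add_card (s := B) (t := D)
      omega
    have h2 : 8 * (B \ D).card ≤ n := by
      have : 8 * ((B \ D).card : ℝ) ≤ n := by nlinarith
      exact_mod_cast this
    omega
  have hCD : (0 : ℝ) < D.card.choose (r + 1) := by
    exact_mod_cast Nat.choose_pos (by omega)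
  have hmD : (n : ℝ) * D.card.choose r ≤ 2 * (r + 1) * D.card.choose (r + 1) := by
    exact_mod_cast mul_choose_le n D.card r hDcard
  have hmB : (n : ℝ) * B.card.choose r ≤ 2 * (r + 1) * B.card.choose (r + 1) := by
    exact_mod_cast mul_choose_le n B.card r (by omega)
  have hsplit : (degIn E {v} D ∅ (r + 1) 0 : ℝ) ≤
      degIn E {v} B ∅ (r + 1) 0 + (D \ B).card * D.card.choose r := by
    exact_mod_cast degIn_le_degIn_add hE v D B
  have hBD : (B.card.choose (r + 1) : ℝ) ≤
      D.card.choose (r + 1) + (B \ D).card * B.card.choose r := by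
    exact_mod_cast choose_le_choose_add_mul B D r
  exact lt_two_mul_mul_of_le hε hηpos.le hε1.le hηr hsplit hv' hBD hin' hout' hmD hmB hCD hCb.le
    (Nat.cast_nonneg _) (Nat.cast_nonneg _)
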